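/- arXiv:0902.2496 — 5 statements merged into one kernel-verified Lean document; each statement's English description precedes it below -/
import Mathlib

section
/- Let D be an integer and let N₃ ≥ 1 be an odd squarefree integer with gcd(N₃, 2D) = 1. Then J(−D, 0; 0, 0; N₃) = (D | N₃), the Jacobi symbol of D modulo N₃; equivalently, (1/N₃) · ∑_{y ∈ ℤ/N₃ℤ} ∑_{x ∈ (ℤ/N₃ℤ)^×} e_{N₃}((y² − D)·x̄) = (D | N₃). -/
open scoped BigOperators

/-- `e_q(a)` for `a ∈ ℤ/qℤ`: `exp(2πi·a/q)`. -/
noncomputable def eZMod (q : ℕ) (a : ZMod q) : ℂ :=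
  Complex.exp (2 * Real.pi * Complex.I * (a.val : ℂ) / (q : ℂ))

/-- The exponential sum
`J(n₁,r₁;n₂,r₂;q) = (1/q)·e_{2q}(r₁r₂)·∑_{y ∈ ℤ/qℤ} ∑_{x ∈ (ℤ/qℤ)ˣ}
  e_q((y²+r₁y+n₁)·x̄ + n₂x + r₂y)`. -/
noncomputable def Jsum (n₁ r₁ n₂ r₂ : ℤ) (q : ℕ) : ℂ :=
  if h : q = 0 then 0 else
    haveI : NeZero q := ⟨h⟩
    (1 / (q : ℂ)) *
      Complex.exp (2 * Real.pi * Complex.I * ((r₁ * r₂ : ℤ) : ℂ) / ((2 * q : ℕ) : ℂ)) *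
      ∑ y : ZMod q, ∑ x : (ZMod q)ˣ,
        eZMod q ((y ^ 2 + (r₁ : ZMod q) * y + (n₁ : ZMod q)) * ((x⁻¹ : (ZMod q)ˣ) : ZMod q)
          + (n₂ : ZMod q) * ((x : (ZMod q)ˣ) : ZMod q) + (r₂ : ZMod q) * y)

section RingSum

variable {R S : Type*} [CommRing R] [CommRing S]

theorem isPrimitive_compAddMonoidHom_ringEquiv (e : R ≃+* S) {ψ : AddChar R ℂ}
    (hψ : ψ.IsPrimitive) :
    (ψ.compAddMonoidHom (e.symm : S ≃+ R).toAddMonoidHom).IsPrimitive := by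
  intro a ha
  obtain ⟨x, hx⟩ := AddChar.ne_one_iff.mp
    (hψ (a := e.symm a) (by simpa using ha))
  exact AddChar.ne_one_iff.mpr ⟨e x, by simpa [AddChar.mulShift_apply] using hx⟩

theorem isPrimitive_compAddMonoidHom_inl {ψ : AddChar (R × S) ℂ} (hψ : ψ.IsPrimitive) :
    (ψ.compAddMonoidHom (AddMonoidHom.inl R S)).IsPrimitive := by
  intro a ha
  obtain ⟨x, hx⟩ := AddChar.ne_one_iff.mp (hψ (a := (a, 0)) (by simpa using ha))
  exact AddChar.ne_one_iff.mpr ⟨x.1, by simpa [AddChar.mulShift_apply, Prod.mul_def] using hx⟩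

theorem isPrimitive_compAddMonoidHom_inr {ψ : AddChar (R × S) ℂ} (hψ : ψ.IsPrimitive) :
    (ψ.compAddMonoidHom (AddMonoidHom.inr R S)).IsPrimitive := by
  intro b hb
  obtain ⟨x, hx⟩ := AddChar.ne_one_iff.mp (hψ (a := (0, b)) (by simpa using hb))
  exact AddChar.ne_one_iff.mpr ⟨x.2, by simpa [AddChar.mulShift_apply, Prod.mul_def] using hx⟩

variable [Fintype R] [DecidableEq R] [Fintype S] [DecidableEq S]

/-- The sum of `ψ ((y² - d) * u)` over all `y` and all units `u` of a finite commutative ring. -/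
noncomputable def sqUnitSum (ψ : AddChar R ℂ) (d : R) : ℂ :=
  ∑ y : R, ∑ u : Rˣ, ψ ((y ^ 2 - d) * u)

theorem sqUnitSum_ringEquiv (e : R ≃+* S) (ψ : AddChar R ℂ) (d : R) :
    sqUnitSum ψ d =
      sqUnitSum (ψ.compAddMonoidHom (e.symm : S ≃+ R).toAddMonoidHom) (e d) := by
  unfold sqUnitSum
  refine Fintype.sum_equiv e.toEquiv _ _ fun y ↦ ?_
  refine Fintype.sum_equiv (Units.mapEquiv e.toMulEquiv).toEquiv _ _ fun u ↦ ?_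
  simp

theorem sqUnitSum_prod (ψ : AddChar (R × S) ℂ) (d : R × S) :
    sqUnitSum ψ d =
      sqUnitSum (ψ.compAddMonoidHom (AddMonoidHom.inl R S)) d.1 *
        sqUnitSum (ψ.compAddMonoidHom (AddMonoidHom.inr R S)) d.2 := by
  have hψ (a : R) (b : S) : ψ (a, b) = ψ (a, 0) * ψ (0, b) := by
    rw [← AddChar.map_add_eq_mul]
    simp
  unfold sqUnitSum
  rw [Fintype.sum_mul_sum, Fintype.sum_prod_type]
  refine Finset.sum_congr rfl fun y _ ↦ Finset.sum_congr rfl fun z _ ↦ ?_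
  rw [Fintype.sum_mul_sum, ← Fintype.sum_equiv MulEquiv.prodUnits.symm.toEquiv
    (fun v : Rˣ × Sˣ ↦ ψ ((y ^ 2 - d.1) * v.1, (z ^ 2 - d.2) * v.2)) _ fun _ ↦ rfl,
    Fintype.sum_prod_type]
  exact Finset.sum_congr rfl fun u _ ↦ Finset.sum_congr rfl fun v _ ↦ hψ _ _

end RingSum

theorem sum_units_mulShift {F : Type*} [Field F] [Fintype F] [DecidableEq F]
    {ψ : AddChar F ℂ} (hψ : ψ.IsPrimitive) (t : F) :
    ∑ u : Fˣ, ψ (t * u) = (if t = 0 then (Fintype.card F : ℂ) else 0) - 1 := by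
  have h := AddChar.sum_mulShift t hψ
  rw [Fintype.sum_eq_add_sum_subtype_ne _ 0,
    ← Fintype.sum_equiv unitsEquivNeZero (fun u : Fˣ ↦ ψ (t * u)) _
      fun u ↦ by simp [mul_comm]] at h
  rw [zero_mul, AddChar.map_zero_eq_one] at h
  push_cast at h
  rw [← h]
  ring

theorem sqUnitSum_field {F : Type*} [Field F] [Fintype F] [DecidableEq F]
    (hF : ringChar F ≠ 2) {ψ : AddChar F ℂ} (hψ : ψ.IsPrimitive) (d : F) :
    sqUnitSum ψ d = Fintype.card F * (quadraticChar F d : ℂ) := by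
  have hcard : ((Finset.univ.filter fun y : F ↦ y ^ 2 = d).card : ℂ) = quadraticChar F d + 1 := by
    have h := quadraticChar_card_sqrts hF d
    rw [Set.toFinset_ofPred] at h
    exact_mod_cast h
  simp only [sqUnitSum, sum_units_mulShift hψ, sub_eq_zero, Finset.sum_sub_distrib]
  rw [← Finset.sum_filter, Finset.sum_const, nsmul_eq_mul, hcard]
  simp
  ring

theorem sqUnitSum_zmod (D : ℤ) (n : ℕ) [hn : NeZero n] (hodd : Odd n) (hsqf : Squarefree n)
    {ψ : AddChar (ZMod n) ℂ} (hψ : ψ.IsPrimitive) :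
    sqUnitSum ψ (D : ZMod n) = n * (jacobiSym D n : ℂ) := by
  revert hn ψ
  induction n using induction_on_primes with
  | zero =>
    intro hn
    exact absurd rfl hn.out
  | one =>
    intro _ ψ hψ
    have (x : ZMod 1) : ψ x = 1 := by rw [Subsingleton.elim x 0, AddChar.map_zero_eq_one]
    simp [sqUnitSum, this]
  | prime_mul p m hp ih =>
    intro hn ψ hψ
    have : Fact p.Prime := ⟨hp⟩
    have : NeZero m := ⟨right_ne_zero_of_mul hn.out⟩
    have hpodd : Odd p := (Nat.odd_mul.mp hodd).1
    have hp2 : ringChar (ZMod p) ≠ 2 := by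
      rw [ZMod.ringChar_zmod_n]
      rintro rfl
      exact absurd hpodd (by decide)
    let e := ZMod.chineseRemainder (Nat.coprime_of_squarefree_mul hsqf)
    have he := isPrimitive_compAddMonoidHom_ringEquiv e hψ
    rw [sqUnitSum_ringEquiv e, sqUnitSum_prod, map_intCast, Prod.fst_intCast, Prod.snd_intCast,
      ih (Nat.odd_mul.mp hodd).2 (hsqf.of_mul_right) (isPrimitive_compAddMonoidHom_inr he),
      sqUnitSum_field hp2 (isPrimitive_compAddMonoidHom_inl he), jacobiSym.mul_right,
      ← jacobiSym.legendreSym.to_jacobiSym p D, legendreSym, ZMod.card p]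
    push_cast
    ring

theorem eZMod_eq_stdAddChar (q : ℕ) [NeZero q] (a : ZMod q) :
    eZMod q a = ZMod.stdAddChar a := by
  rw [ZMod.stdAddChar_apply, ZMod.toCircle_apply, eZMod]

/-- For `N₃ ≥ 1` odd squarefree with `gcd(N₃, 2D) = 1`, the exponential sum
`J(−D,0;0,0;N₃)` equals the Jacobi symbol `(D | N₃)`. -/
theorem Jsum_eq_jacobiSym
    (D : ℤ) (N₃ : ℕ) (hN₃ : 1 ≤ N₃) (hodd : Odd N₃) (hsqf : Squarefree N₃)
    (hcop : IsCoprime (N₃ : ℤ) (2 * D)) :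
    Jsum (-D) 0 0 0 N₃ = (jacobiSym D N₃ : ℂ) := by
  have : NeZero N₃ := ⟨by lia⟩
  have hN : (N₃ : ℂ) ≠ 0 := Nat.cast_ne_zero.mpr (NeZero.ne N₃)
  have hsum : ∑ y : ZMod N₃, ∑ x : (ZMod N₃)ˣ,
      ZMod.stdAddChar ((y ^ 2 - (D : ZMod N₃)) * ((x⁻¹ : (ZMod N₃)ˣ) : ZMod N₃)) =
        N₃ * (jacobiSym D N₃ : ℂ) := by
    rw [← sqUnitSum_zmod D N₃ hodd hsqf (ZMod.isPrimitive_stdAddChar N₃), sqUnitSum]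
    exact Finset.sum_congr rfl fun y _ ↦ Fintype.sum_equiv (Equiv.inv _) _ _ fun _ ↦ rfl
  simp [Jsum, eZMod_eq_stdAddChar, NeZero.ne N₃, ← sub_eq_add_neg, hsum, hN]
end

section
/- Let D be a fundamental discriminant, let l, m ∈ ℤ, let e ≥ 1 and q ≥ 1 be integers, and let 𝒩₂ ≥ 1 be an odd squarefree integer coprime to both D and q. Write 𝒩₂ = 𝒩₃𝒩₄ where 𝒩₄ := gcd(𝒩₂, e) and 𝒩₃ := 𝒩₂/𝒩₄ (so that 𝒩₄ | e and gcd(𝒩₃, e) = 1), and set e′ := e/𝒩₄. Let b be any integer with b𝒩₂ ≡ 1 (mod q). Then J(−e²D, 0; m·b, l; q) = χ_D(𝒩₃) · J(−e′²D, 0; m𝒩₂, l𝒩₂; q𝒩₃), where χ_D(𝒩₃) is the Jacobi symbol (D | 𝒩₃). -/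
open scoped BigOperators

/-- A fundamental discriminant: `D ≡ 1 (mod 4)` squarefree, or `D = 4m` with `m`
squarefree and `m ≡ 2, 3 (mod 4)`. -/
def IsFundamentalDiscriminant (D : ℤ) : Prop :=
  (D % 4 = 1 ∧ Squarefree D) ∨
    ∃ m : ℤ, D = 4 * m ∧ Squarefree m ∧ (m % 4 = 2 ∨ m % 4 = 3)

/-- The unnormalised sum `∑_y ∑_x ψ((y² + A)x⁻¹ + Bx + Cy)` over a finite commutative ring. -/
noncomputable def quadKloosterman {R : Type*} [CommRing R] [Fintype R] [Fintype Rˣ]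
    (ψ : AddChar R ℂ) (A B C : R) : ℂ :=
  ∑ y : R, ∑ x : Rˣ, ψ ((y ^ 2 + A) * ((x⁻¹ : Rˣ) : R) + B * (x : R) + C * y)

lemma quadKloosterman_unit_sq_mul {R : Type*} [CommRing R] [Fintype R] [Fintype Rˣ]
    (ψ : AddChar R ℂ) (u : Rˣ) (A B C : R) :
    quadKloosterman ψ ((u : R) ^ 2 * A) B C = quadKloosterman ψ A ((u : R) ^ 2 * B) (u * C) := by
  unfold quadKloosterman
  rw [← Equiv.sum_comp (Units.mulLeft u)]
  refine Finset.sum_congr rfl fun y _ => ?_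
  rw [← Equiv.sum_comp (Equiv.mulLeft (u ^ 2))]
  refine Finset.sum_congr rfl fun x _ => ?_
  congr 1
  have h : ((u⁻¹ : Rˣ) : R) * u = 1 := u.inv_mul
  simp only [Units.mulLeft_apply, Equiv.coe_mulLeft, mul_inv, Units.val_mul, ← inv_pow,
    Units.val_pow_eq_pow_val]
  linear_combination (y ^ 2 + A) * ((x⁻¹ : Rˣ) : R) * (((u⁻¹ : Rˣ) : R) * u + 1) * h

lemma quadKloosterman_eq_mul_of_ringEquiv_prod {R S T : Type*} [CommRing R] [CommRing S] [CommRing T]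
    [Fintype R] [Fintype S] [Fintype T] [Fintype Rˣ] [Fintype Sˣ] [Fintype Tˣ]
    (φ : R ≃+* S × T) (ψ : AddChar R ℂ) (ψ₁ : AddChar S ℂ) (ψ₂ : AddChar T ℂ) (u : Sˣ) (v : Tˣ)
    (hψ : ∀ r s t, φ r = ((u : S) * s, (v : T) * t) → ψ r = ψ₁ s * ψ₂ t)
    {A B C : R} {A₁ B₁ C₁ : S} {A₂ B₂ C₂ : T} (hA : φ A = (A₁, A₂))
    (hB : φ B = ((u : S) ^ 2 * B₁, (v : T) ^ 2 * B₂)) (hC : φ C = ((u : S) * C₁, (v : T) * C₂)) :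
    quadKloosterman ψ A B C = quadKloosterman ψ₁ A₁ B₁ C₁ * quadKloosterman ψ₂ A₂ B₂ C₂ := by
  let e : Rˣ ≃ Sˣ × Tˣ := ((Units.mapEquiv φ.toMulEquiv).trans MulEquiv.prodUnits).toEquiv.trans
    (Equiv.prodCongr (Equiv.mulLeft u) (Equiv.mulLeft v))
  unfold quadKloosterman
  rw [Finset.sum_mul_sum]
  refine Eq.trans ?_ (Fintype.sum_prod_type' _)
  refine Fintype.sum_equiv φ.toEquiv _ _ fun y => ?_
  rw [Finset.sum_mul_sum]
  refine Eq.trans ?_ (Fintype.sum_prod_type' _)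
  refine Fintype.sum_equiv e _ _ fun x => ?_
  apply hψ
  have he₁ : (((e x).1 : Sˣ) : S) = u * (φ x).1 := rfl
  have he₂ : (((e x).2 : Tˣ) : T) = v * (φ x).2 := rfl
  have hi₁ : ((((e x).1)⁻¹ : Sˣ) : S) = ((u⁻¹ : Sˣ) : S) * (φ ((x⁻¹ : Rˣ) : R)).1 := by
    rw [mul_comm]
    exact congrArg Units.val (mul_inv_rev u (MulEquiv.prodUnits (Units.mapEquiv φ.toMulEquiv x)).1)
  have hi₂ : ((((e x).2)⁻¹ : Tˣ) : T) = ((v⁻¹ : Tˣ) : T) * (φ ((x⁻¹ : Rˣ) : R)).2 := by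
    rw [mul_comm]
    exact congrArg Units.val (mul_inv_rev v (MulEquiv.prodUnits (Units.mapEquiv φ.toMulEquiv x)).2)
  have hu : (u : S) * ((u⁻¹ : Sˣ) : S) = 1 := u.mul_inv
  have hv : (v : T) * ((v⁻¹ : Tˣ) : T) = 1 := v.mul_inv
  rw [he₁, he₂, hi₁, hi₂]
  simp only [map_add, map_mul, map_pow, hA, hB, hC]
  refine Prod.ext ?_ ?_
  · simp only [Prod.fst_add, Prod.fst_mul, Prod.pow_fst, RingEquiv.toEquiv_eq_coe, EquivLike.coe_coe]
    linear_combination -((φ y).1 ^ 2 + A₁) * (φ ((x⁻¹ : Rˣ) : R)).1 * hu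
  · simp only [Prod.snd_add, Prod.snd_mul, Prod.pow_snd, RingEquiv.toEquiv_eq_coe, EquivLike.coe_coe]
    linear_combination -((φ y).2 ^ 2 + A₂) * (φ ((x⁻¹ : Rˣ) : R)).2 * hv

lemma ZMod.stdAddChar_eq_mul_of_chineseRemainder {m n : ℕ} [NeZero m] [NeZero n]
    (h : m.Coprime n) (r : ZMod (m * n)) (s : ZMod m) (t : ZMod n)
    (hr : ZMod.chineseRemainder h r = (n * s, m * t)) :
    ZMod.stdAddChar r = ZMod.stdAddChar s * ZMod.stdAddChar t := by
  obtain ⟨s, rfl⟩ := ZMod.intCast_surjective s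
  obtain ⟨t, rfl⟩ := ZMod.intCast_surjective t
  obtain rfl : r = ((n * s + m * t : ℤ) : ZMod (m * n)) := by
    apply (ZMod.chineseRemainder h).injective
    rw [hr, map_intCast]
    ext <;> simp
  rw [ZMod.stdAddChar_coe, ZMod.stdAddChar_coe, ZMod.stdAddChar_coe, ← Complex.exp_add]
  congr 1
  have hm : (m : ℂ) ≠ 0 := NeZero.ne _
  have hn : (n : ℂ) ≠ 0 := NeZero.ne _
  push_cast
  field_simp

/-- Twisted multiplicativity in the modulus. -/
lemma quadKloosterman_zmod_mul {m n : ℕ} [NeZero m] [NeZero n] (h : m.Coprime n)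
    (A B C B₁ C₁ B₂ C₂ : ℤ) (hB₁ : (B : ZMod m) = n ^ 2 * B₁) (hC₁ : (C : ZMod m) = n * C₁)
    (hB₂ : (B : ZMod n) = m ^ 2 * B₂) (hC₂ : (C : ZMod n) = m * C₂) :
    quadKloosterman (ZMod.stdAddChar (N := m * n)) A B C =
      quadKloosterman (ZMod.stdAddChar (N := m)) A B₁ C₁ *
        quadKloosterman (ZMod.stdAddChar (N := n)) A B₂ C₂ := by
  refine quadKloosterman_eq_mul_of_ringEquiv_prod (ZMod.chineseRemainder h) _ _ _
    (ZMod.unitOfCoprime n h.symm) (ZMod.unitOfCoprime m h) ?_ (by simp; rfl) ?_ ?_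
  · exact ZMod.stdAddChar_eq_mul_of_chineseRemainder h
  · rw [map_intCast]
    exact Prod.ext hB₁ hB₂
  · rw [map_intCast]
    exact Prod.ext hC₁ hC₂

lemma quadKloosterman_zmod_prime {p : ℕ} [Fact p.Prime] (hp : p ≠ 2) (a : ℤ) :
    quadKloosterman (ZMod.stdAddChar (N := p)) (-a : ℤ) 0 0 = p * (legendreSym p a : ℂ) := by
  have hinner (b : ZMod p) : ∑ x : (ZMod p)ˣ, ZMod.stdAddChar (b * ((x⁻¹ : (ZMod p)ˣ) : ZMod p)) =
      (if b = 0 then (p : ℂ) else 0) - 1 := by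
    have hsum := AddChar.sum_mulShift b (ZMod.isPrimitive_stdAddChar p)
    rw [ZMod.card, Fintype.sum_eq_add_sum_subtype_ne _ 0] at hsum
    rw [← Equiv.sum_comp (Equiv.inv (ZMod p)ˣ)]
    simp only [Equiv.inv_apply, inv_inv]
    rw [Fintype.sum_equiv unitsEquivNeZero _ (fun x : {x : ZMod p // x ≠ 0} =>
      ZMod.stdAddChar ((x : ZMod p) * b)) fun x => by rw [mul_comm]; rfl]
    rw [zero_mul, AddChar.map_zero_eq_one] at hsum
    rw [eq_sub_iff_add_eq', hsum]
    split_ifs <;> simp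
  unfold quadKloosterman
  have hcard := legendreSym.card_sqrts p hp a
  simp only [zero_mul, add_zero, hinner, Finset.sum_sub_distrib]
  rw [← Finset.sum_filter, Finset.sum_const, Finset.sum_const, Finset.card_univ, ZMod.card]
  have hset : {x : ZMod p | x ^ 2 = a}.toFinset =
      Finset.univ.filter fun y : ZMod p => y ^ 2 + ((-a : ℤ) : ZMod p) = 0 := by
    ext y
    simp [← sub_eq_add_neg, sub_eq_zero]
  rw [hset] at hcard
  rw [nsmul_eq_mul, ← Int.cast_natCast (R := ℂ) (Finset.card _), hcard]
  push_cast
  ring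

lemma quadKloosterman_zmod_squarefree (n : ℕ) [NeZero n] (hodd : Odd n) (hsq : Squarefree n)
    (a : ℤ) : quadKloosterman (ZMod.stdAddChar (N := n)) (-a : ℤ) 0 0 = n * (jacobiSym a n : ℂ) := by
  rename_i hz
  revert hz
  induction n using induction_on_primes with
  | zero => exact absurd hsq not_squarefree_zero
  | one =>
    intro _
    simp [quadKloosterman, Subsingleton.elim _ (0 : ZMod 1)]
  | prime_mul p n hp ih =>
    intro _
    have := Fact.mk hp
    obtain ⟨hpo, hno⟩ := Nat.odd_mul.mp hodd
    obtain ⟨hcop, -, hn⟩ := Nat.squarefree_mul_iff.mp hsq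
    have : NeZero n := ⟨hn.ne_zero⟩
    have hp2 : p ≠ 2 := by rintro rfl; exact absurd hpo (by decide)
    have := quadKloosterman_zmod_mul hcop (-a) 0 0 0 0 0 0 (by simp) (by simp) (by simp) (by simp)
    simp only [Int.cast_zero] at this
    rw [this, quadKloosterman_zmod_prime hp2, ih hno hn, jacobiSym.mul_right,
      jacobiSym.legendreSym.to_jacobiSym]
    push_cast
    ring

lemma Jsum_zero_eq_quadKloosterman (n₁ n₂ r₂ : ℤ) (q : ℕ) [NeZero q] :
    Jsum n₁ 0 n₂ r₂ q = 1 / (q : ℂ) * quadKloosterman (ZMod.stdAddChar (N := q)) n₁ n₂ r₂ := by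
  have he (a : ZMod q) : eZMod q a = ZMod.stdAddChar a := by
    rw [ZMod.stdAddChar_apply, ZMod.toCircle_apply, eZMod]
  simp [Jsum, quadKloosterman, he, NeZero.ne q]

/-- Removal of the residual inverse `\overline{𝒩₂}`: with `𝒩₂ = 𝒩₃𝒩₄`,
`𝒩₄ = gcd(𝒩₂, e)`, `e = e'𝒩₄`, and `b` an inverse of `𝒩₂` mod `q`,
`J(−e²D,0;mb,l;q) = χ_D(𝒩₃) · J(−e'²D,0;m𝒩₂,l𝒩₂;q𝒩₃)`. -/
theorem Jsum_inverse_removal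
    (D : ℤ) (hD : IsFundamentalDiscriminant D) (l m : ℤ)
    (e q N₂ N₃ N₄ e' : ℕ) (he : 1 ≤ e) (hq : 1 ≤ q) (hN₂ : 1 ≤ N₂)
    (hN₂odd : Odd N₂) (hN₂sqf : Squarefree N₂)
    (hN₂D : IsCoprime (N₂ : ℤ) D) (hN₂q : Nat.Coprime N₂ q)
    (hN₄ : N₄ = Nat.gcd N₂ e) (hN₂eq : N₂ = N₃ * N₄) (he' : e = e' * N₄)
    (b : ℤ) (hb : b * (N₂ : ℤ) ≡ 1 [ZMOD (q : ℤ)]) :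
    Jsum (-(e : ℤ) ^ 2 * D) 0 (m * b) l q =
      (jacobiSym D N₃ : ℂ) *
        Jsum (-(e' : ℤ) ^ 2 * D) 0 (m * (N₂ : ℤ)) (l * (N₂ : ℤ)) (q * N₃) := by
  have hpos : N₃ ≠ 0 ∧ N₄ ≠ 0 := by
    rw [hN₂eq] at hN₂; exact mul_ne_zero_iff.mp (by omega)
  have : NeZero N₃ := ⟨hpos.1⟩
  have : NeZero q := ⟨by omega⟩
  have hsq := hN₂sqf
  rw [hN₂eq] at hsq hN₂q hN₂odd
  obtain ⟨h34, hsq₃, -⟩ := Nat.squarefree_mul_iff.mp hsq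
  have hq₃ : q.Coprime N₃ := (Nat.Coprime.coprime_mul_right hN₂q).symm
  have hq₄ : N₄.Coprime q := Nat.Coprime.coprime_mul_left hN₂q
  have hD₃ : D.gcd N₃ = 1 := by
    rw [hN₂eq] at hN₂D
    push_cast at hN₂D
    exact Int.isCoprime_iff_gcd_eq_one.mp hN₂D.of_mul_left_left.symm
  have he₃ : Int.gcd (e' : ℤ) N₃ = 1 := by
    have h : N₃.Coprime e' := by
      have := hN₄
      rw [hN₂eq, he', Nat.gcd_mul_right] at this
      exact Nat.eq_of_mul_eq_mul_right (Nat.pos_of_ne_zero hpos.2) (by rw [one_mul]; exact this.symm)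
    exact h.symm
  have hjac : jacobiSym ((e' : ℤ) ^ 2 * D) N₃ = jacobiSym D N₃ := by
    rw [jacobiSym.mul_left, jacobiSym.sq_one' he₃, one_mul]
  have hjsq : (jacobiSym D N₃ : ℂ) ^ 2 = 1 := by exact_mod_cast jacobiSym.sq_one hD₃
  have hbq : (b : ZMod q) * (N₃ * N₄) = 1 := by
    have := (ZMod.intCast_eq_intCast_iff _ _ q).mpr hb
    rw [hN₂eq] at this
    exact_mod_cast this
  have hN₃0 : (N₃ : ZMod N₃) = 0 := ZMod.natCast_self N₃
  have hcrt := quadKloosterman_zmod_mul hq₃ (-((e' : ℤ) ^ 2 * D)) (m * N₂) (l * N₂)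
    (N₄ ^ 2 * (m * b)) (N₄ * l) 0 0
    (by rw [hN₂eq]; push_cast; linear_combination -(m * N₃ * N₄ : ZMod q) * hbq)
    (by rw [hN₂eq]; push_cast; ring)
    (by rw [hN₂eq]; push_cast; rw [hN₃0]; ring)
    (by rw [hN₂eq]; push_cast; rw [hN₃0]; ring)
  have hscale := quadKloosterman_unit_sq_mul (ZMod.stdAddChar (N := q)) (ZMod.unitOfCoprime N₄ hq₄)
    ((-((e' : ℤ) ^ 2 * D) : ℤ) : ZMod q) ((m * b : ℤ) : ZMod q) (l : ZMod q)
  rw [Int.cast_zero, quadKloosterman_zmod_squarefree N₃ (Nat.odd_mul.mp hN₂odd).1 hsq₃, hjac] at hcrt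
  have hA : ((-(e : ℤ) ^ 2 * D : ℤ) : ZMod q) =
      (ZMod.unitOfCoprime N₄ hq₄ : ZMod q) ^ 2 * ((-((e' : ℤ) ^ 2 * D) : ℤ) : ZMod q) := by
    rw [ZMod.coe_unitOfCoprime, he']
    push_cast
    ring
  rw [Jsum_zero_eq_quadKloosterman, Jsum_zero_eq_quadKloosterman, hA, hscale, neg_mul, hcrt,
    ZMod.coe_unitOfCoprime]
  have hq0 : (q : ℂ) ≠ 0 := NeZero.ne _
  have hn0 : (N₃ : ℂ) ≠ 0 := NeZero.ne _
  push_cast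
  field_simp
  rw [hjsq, mul_one]
end

section
/- With the above data, for every integer n one has φ(n) · ∑_{q=1}^∞ Δ_q(|n|) · c_q(n) = 1 if n = 0 and = 0 if n ≠ 0, where c_q(n) := ∑_{d ∈ (ℤ/qℤ)^×} exp(2πi n d / q) is the Ramanujan sum (for each fixed n, only finitely many terms of the sum over q are nonzero, so the sum is well defined). -/
open scoped BigOperators

/-- `Δ_q(u) := ∑_{r=1}^∞ (1/(qr))·[ω(qr) − ω(u/(qr))]`. -/
noncomputable def Delta (ω : ℝ → ℝ) (q : ℕ) (u : ℝ) : ℝ :=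
  ∑' r : ℕ, (1 / ((q : ℝ) * ((r : ℝ) + 1))) *
    (ω ((q : ℝ) * ((r : ℝ) + 1)) - ω (u / ((q : ℝ) * ((r : ℝ) + 1))))

/-- The Ramanujan sum `c_q(n) = ∑_{d ∈ (ℤ/qℤ)ˣ} exp(2πi·n·d/q)`. -/
noncomputable def ramanujanSum (q : ℕ) (n : ℤ) : ℂ :=
  if h : q = 0 then 0 else
    haveI : NeZero q := ⟨h⟩
    ∑ d : (ZMod q)ˣ,
      Complex.exp (2 * Real.pi * Complex.I * (n : ℂ) * (((d : ZMod q)).val : ℂ) / (q : ℂ))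

/-- The units of `ZMod q` parametrize the primitive `q`-th roots of unity. -/
theorem ramanujanSum_eq_sum_primitiveRoots {q : ℕ} (hq : q ≠ 0) (n : ℤ) :
    ramanujanSum q n = ∑ ζ ∈ primitiveRoots q ℂ, ζ ^ n := by
  have : NeZero q := ⟨hq⟩
  rw [ramanujanSum, dif_neg hq]
  refine Finset.sum_bij
    (fun d _ => Complex.exp (2 * Real.pi * Complex.I * (((d : ZMod q).val : ℂ) / (q : ℂ))))
    ?_ ?_ ?_ ?_
  · intro d _
    rw [mem_primitiveRoots (Nat.pos_of_ne_zero hq), Complex.isPrimitiveRoot_iff _ _ hq]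
    exact ⟨(d : ZMod q).val, ZMod.val_lt _, ZMod.val_coe_unit_coprime d, rfl⟩
  · intro a _ b _ hab
    have hpow : ∀ k : ℕ, Complex.exp (2 * Real.pi * Complex.I * ((k : ℂ) / (q : ℂ))) =
        Complex.exp (2 * Real.pi * Complex.I / (q : ℂ)) ^ k := by
      intro k
      rw [← Complex.exp_nat_mul]
      congr 1
      ring
    simp only [hpow] at hab
    exact Units.ext (ZMod.val_injective q
      ((Complex.isPrimitiveRoot_exp q hq).pow_inj (ZMod.val_lt _) (ZMod.val_lt _) hab))
  · intro ζ hζ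
    rw [mem_primitiveRoots (Nat.pos_of_ne_zero hq), Complex.isPrimitiveRoot_iff _ _ hq] at hζ
    obtain ⟨k, hk, hcop, rfl⟩ := hζ
    refine ⟨ZMod.unitOfCoprime k hcop, Finset.mem_univ _, ?_⟩
    simp [ZMod.val_natCast, Nat.mod_eq_of_lt hk]
  · intro d _
    rw [← Complex.exp_int_mul]
    congr 1
    ring

theorem sum_nthRootsFinset_zpow {m : ℕ} (hm : m ≠ 0) (n : ℤ) :
    ∑ ζ ∈ Polynomial.nthRootsFinset m (1 : ℂ), ζ ^ n = if (m : ℤ) ∣ n then (m : ℂ) else 0 := by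
  have hμ := Complex.isPrimitiveRoot_exp m hm
  set μ := Complex.exp (2 * Real.pi * Complex.I / (m : ℂ))
  have hpos := Nat.pos_of_ne_zero hm
  split_ifs with h
  · rw [Finset.sum_congr rfl (g := fun _ => (1 : ℂ)), Finset.sum_const,
      hμ.card_nthRootsFinset, nsmul_one]
    intro ζ hζ
    obtain ⟨k, rfl⟩ := h
    rw [Polynomial.mem_nthRootsFinset hpos] at hζ
    rw [zpow_mul, zpow_natCast, hζ, one_zpow]
  · have hμ0 : μ ≠ 0 := hμ.ne_zero hm
    have hμn : μ ^ n ≠ 1 := fun h1 => h ((hμ.zpow_eq_one_iff_dvd n).mp h1)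
    have key : ∑ ζ ∈ Polynomial.nthRootsFinset m (1 : ℂ), (μ * ζ) ^ n =
        ∑ ζ ∈ Polynomial.nthRootsFinset m (1 : ℂ), ζ ^ n := by
      refine Finset.sum_nbij' (fun ζ => μ * ζ) (fun ζ => μ⁻¹ * ζ) ?_ ?_ ?_ ?_ ?_
      · intro ζ hζ
        rw [Polynomial.mem_nthRootsFinset hpos] at hζ ⊢
        rw [mul_pow, hζ, hμ.pow_eq_one, one_mul]
      · intro ζ hζ
        rw [Polynomial.mem_nthRootsFinset hpos] at hζ ⊢
        rw [mul_pow, inv_pow, hζ, hμ.pow_eq_one, inv_one, one_mul]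
      · intro ζ _
        exact inv_mul_cancel_left₀ hμ0 ζ
      · intro ζ _
        exact mul_inv_cancel_left₀ hμ0 ζ
      · intro ζ _
        rfl
    simp only [mul_zpow, ← Finset.mul_sum] at key
    by_contra hS
    exact hμn (mul_right_cancel₀ hS (key.trans (one_mul _).symm))

theorem sum_divisors_ramanujanSum {m : ℕ} (hm : m ≠ 0) (n : ℤ) :
    ∑ q ∈ m.divisors, ramanujanSum q n = if (m : ℤ) ∣ n then (m : ℂ) else 0 := by
  have : NeZero m := ⟨hm⟩
  rw [← sum_nthRootsFinset_zpow hm,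
    IsPrimitiveRoot.nthRoots_one_eq_biUnion_primitiveRoots, Finset.sum_biUnion]
  · exact Finset.sum_congr rfl fun q hq =>
      ramanujanSum_eq_sum_primitiveRoots (Nat.pos_of_mem_divisors hq).ne' n
  · intro a _ b _ hab
    exact IsPrimitiveRoot.disjoint hab

/-- The summand `(1/m)·[ω(m) − ω(u/m)]` of `Delta`, as a function of `m = qr`. -/
noncomputable def deltaTerm (ω : ℝ → ℝ) (u : ℝ) (m : ℕ) : ℝ :=
  (1 / (m : ℝ)) * (ω m - ω (u / m))

theorem deltaTerm_zero (ω : ℝ → ℝ) (u : ℝ) : deltaTerm ω u 0 = 0 := by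
  simp [deltaTerm]

theorem Delta_eq_sum {ω : ℝ → ℝ} {u : ℝ} {N : ℕ} (hN : ∀ m, N ≤ m → deltaTerm ω u m = 0)
    {q : ℕ} (hq : q ≠ 0) :
    Delta ω q u = ∑ m ∈ Finset.range N, if q ∣ m then deltaTerm ω u m else 0 := by
  have hinj : Function.Injective fun r : ℕ => q * (r + 1) := fun a b h =>
    Nat.succ_injective (Nat.eq_of_mul_eq_mul_left (Nat.pos_of_ne_zero hq) h)
  rw [← tsum_eq_sum (L := .unconditional ℕ)
    (f := fun m => if q ∣ m then deltaTerm ω u m else 0), ← hinj.tsum_eq]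
  · refine tsum_congr fun r => ?_
    simp [deltaTerm]
  · intro m hm
    rw [Function.mem_support] at hm
    obtain ⟨⟨k, rfl⟩, h⟩ : q ∣ m ∧ deltaTerm ω u m ≠ 0 := by simpa using hm
    have hk : k ≠ 0 := by
      rintro rfl
      exact h (deltaTerm_zero ω u)
    exact ⟨k - 1, by simp [Nat.sub_add_cancel (Nat.pos_of_ne_zero hk)]⟩
  · intro m hm
    simp [hN m (by simpa using hm)]

theorem sum_range_dvd_eq_sum_divisors {m N : ℕ} (hm : m ≠ 0) (hmN : m ≤ N) (f : ℕ → ℂ) :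
    ∑ q ∈ Finset.range N, (if q + 1 ∣ m then f (q + 1) else 0) = ∑ q ∈ m.divisors, f q := by
  rw [← Finset.sum_filter]
  refine Finset.sum_nbij' (fun q => q + 1) (fun q => q - 1) ?_ ?_ ?_ ?_ ?_
  · intro q hq
    simp_all
  · intro q hq
    have h0 := Nat.pos_of_mem_divisors hq
    have hd := Nat.dvd_of_mem_divisors hq
    have hle := Nat.le_of_dvd (Nat.pos_of_ne_zero hm) hd
    rw [Finset.mem_filter, Finset.mem_range, Nat.sub_add_cancel h0]
    exact ⟨by omega, hd⟩
  · intro q _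
    rfl
  · intro q hq
    exact Nat.sub_add_cancel (Nat.pos_of_mem_divisors hq)
  · intro q _
    rfl

theorem tsum_Delta_mul_ramanujanSum {ω : ℝ → ℝ} {u : ℝ} {N : ℕ}
    (hN : ∀ m, N ≤ m → deltaTerm ω u m = 0) (n : ℤ) :
    ∑' q : ℕ, ((Delta ω (q + 1) u : ℝ) : ℂ) * ramanujanSum (q + 1) n =
      ((∑ m ∈ (Finset.range N).filter (fun m : ℕ => m ≠ 0 ∧ (m : ℤ) ∣ n), (ω m - ω (u / m)) : ℝ) : ℂ) := by
  have hD : ∀ q : ℕ, Delta ω (q + 1) u =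
      ∑ m ∈ Finset.range N, if q + 1 ∣ m then deltaTerm ω u m else 0 := fun q =>
    Delta_eq_sum hN q.succ_ne_zero
  simp only [hD]
  rw [tsum_eq_sum (s := Finset.range N)]
  · simp only [Complex.ofReal_sum, Finset.sum_mul]
    rw [Finset.sum_comm, Finset.sum_filter]
    refine Finset.sum_congr rfl fun m hm => ?_
    rcases eq_or_ne m 0 with rfl | hm0
    · simp [deltaTerm_zero]
    · have hmC : (m : ℂ) ≠ 0 := Nat.cast_ne_zero.mpr hm0
      calc _ = (deltaTerm ω u m : ℂ) * ∑ q ∈ Finset.range N,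
              (if q + 1 ∣ m then ramanujanSum (q + 1) n else 0) := by
            rw [Finset.mul_sum]
            refine Finset.sum_congr rfl fun q _ => ?_
            split_ifs <;> simp
        _ = _ := by
            rw [sum_range_dvd_eq_sum_divisors hm0 (Finset.mem_range.mp hm).le
              (fun q => ramanujanSum q n), sum_divisors_ramanujanSum hm0]
            by_cases hd : (m : ℤ) ∣ n
            · simp only [hd, hm0, ne_eq, not_false_eq_true, and_self, if_true, deltaTerm]
              push_cast
              field_simp
            · simp [hd]
  · intro q hq
    rw [Finset.sum_eq_zero, Complex.ofReal_zero, zero_mul]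
    intro m hm
    split_ifs with h
    · rcases eq_or_ne m 0 with rfl | hm0
      · exact deltaTerm_zero ω u
      · have := Nat.le_of_dvd (Nat.pos_of_ne_zero hm0) h
        simp only [Finset.mem_range] at hq hm
        omega
    · rfl

theorem sum_divisors_sub_eq_zero (ω : ℝ → ℝ) (k : ℕ) :
    ∑ m ∈ k.divisors, (ω m - ω ((k : ℝ) / m)) = 0 := by
  rw [Finset.sum_sub_distrib, sub_eq_zero, ← Nat.sum_div_divisors k (fun m => ω m)]
  refine Finset.sum_congr rfl fun m hm => ?_
  rw [Nat.cast_div (Nat.dvd_of_mem_divisors hm)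
    (Nat.cast_ne_zero.mpr (Nat.pos_of_mem_divisors hm).ne')]

/-- The `δ`-symbol identity: for every integer `n`,
`φ(n) · ∑_{q=1}^∞ Δ_q(|n|) · c_q(n)` equals `1` if `n = 0` and `0` otherwise. -/
theorem delta_symbol_identity
    (U Ω : ℝ) (hU : 0 < U) (hΩ : 0 < Ω)
    (W : ℝ → ℝ) (hW : ContDiff ℝ (⊤ : ℕ∞) W) (hWsupp : tsupport W ⊆ Set.Ioo (-1) 1)
    (hW0 : W 0 = 1)
    (ω : ℝ → ℝ) (hω : ContDiff ℝ (⊤ : ℕ∞) ω) (hωsupp : tsupport ω ⊆ Set.Ioo Ω (2 * Ω))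
    (hωsum : ∑' r : ℕ, ω ((r : ℝ) + 1) = 1)
    (c : ℕ → ℝ) (hc : ∀ i : ℕ, 0 < c i ∧
      ∀ x : ℝ, |iteratedDeriv i ω x| ≤ c i * Ω ^ (-(i : ℝ) - 1)) :
    ∀ n : ℤ,
      ((W ((n : ℝ) / U) : ℝ) : ℂ) *
          ∑' q : ℕ, ((Delta ω (q + 1) |(n : ℝ)| : ℝ) : ℂ) * ramanujanSum (q + 1) n =
        if n = 0 then 1 else 0 := by
  intro n
  have hsupp : ∀ x, ω x ≠ 0 → Ω < x ∧ x < 2 * Ω := fun x hx =>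
    hωsupp (subset_tsupport ω (Function.mem_support.mpr hx))
  have hω0 : ω 0 = 0 := by
    by_contra h
    exact absurd (hsupp 0 h).1 (not_lt.mpr hΩ.le)
  obtain ⟨N, hNlt⟩ := exists_nat_gt (2 * Ω + |(n : ℝ)| / Ω + |(n : ℝ)|)
  have hu : 0 ≤ |(n : ℝ)| := abs_nonneg _
  have huΩ : 0 ≤ |(n : ℝ)| / Ω := div_nonneg hu hΩ.le
  have hlarge : ∀ m : ℕ, N ≤ m → ω m = 0 := by
    intro m hm
    have hm' : (N : ℝ) ≤ m := Nat.cast_le.mpr hm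
    by_contra h
    linarith [(hsupp _ h).2]
  have hN : ∀ m, N ≤ m → deltaTerm ω |(n : ℝ)| m = 0 := by
    intro m hm
    have hm' : (N : ℝ) ≤ m := Nat.cast_le.mpr hm
    have hmpos : (0 : ℝ) < m := by linarith
    have h2 : ω (|(n : ℝ)| / m) = 0 := by
      by_contra h
      have h3 := (hsupp _ h).1
      rw [lt_div_iff₀ hmpos, mul_comm, ← lt_div_iff₀ hΩ] at h3
      linarith
    rw [deltaTerm, hlarge m hm, h2, sub_zero, mul_zero]
  rw [tsum_Delta_mul_ramanujanSum hN]
  split_ifs with hn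
  · subst hn
    have hsum : ∑ m ∈ Finset.range N, ω m = 1 := by
      rw [← hωsum, ← tsum_eq_sum (L := .unconditional ℕ) (f := fun m : ℕ => ω m)]
      · rw [← Nat.succ_injective.tsum_eq]
        · simp
        · intro m hm
          rw [Function.mem_support] at hm
          refine ⟨m - 1, Nat.succ_pred_eq_of_ne_zero ?_⟩
          rintro rfl
          exact hm (by simpa using hω0)
      · intro m hm
        exact hlarge m (by simpa using hm)
    have hfilter : ∑ m ∈ (Finset.range N).filter (fun m : ℕ => m ≠ 0 ∧ (m : ℤ) ∣ 0),
        (ω m - ω (|((0 : ℤ) : ℝ)| / m)) = 1 := by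
      rw [← hsum, Finset.sum_filter]
      refine Finset.sum_congr rfl fun m _ => ?_
      rcases eq_or_ne m 0 with rfl | hm0
      · simp [hω0]
      · simp [hω0, hm0]
    rw [hfilter]
    simp [hW0]
  · have hcast : |(n : ℝ)| = (n.natAbs : ℝ) := by
      rw [Nat.cast_natAbs, Int.cast_abs]
    have hset : (Finset.range N).filter (fun m : ℕ => m ≠ 0 ∧ (m : ℤ) ∣ n) = n.natAbs.divisors := by
      ext m
      rw [Finset.mem_filter, Finset.mem_range, Nat.mem_divisors, Int.natCast_dvd]
      have hn0 : n.natAbs ≠ 0 := Int.natAbs_ne_zero.mpr hn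
      constructor
      · rintro ⟨_, _, h⟩
        exact ⟨h, hn0⟩
      · rintro ⟨h, _⟩
        have hle := Nat.le_of_dvd (Nat.pos_of_ne_zero hn0) h
        have hlt : n.natAbs < N := by
          have : (n.natAbs : ℝ) < N := by linarith
          exact_mod_cast this
        exact ⟨by omega, (Nat.pos_of_dvd_of_pos h (Nat.pos_of_ne_zero hn0)).ne', h⟩
    rw [hset, hcast, sum_divisors_sub_eq_zero, Complex.ofReal_zero, mul_zero]
end

section
/- With the above data, for every integer i ≥ 1 there is a constant C_i > 0, depending only on i and on the constants c_0, …, c_i bounding the derivatives of ω (and independent of q, u, Ω, U), such that for every integer q ≥ 1 and every u ∈ ℝ the i-th derivative of Δ_q with respect to u satisfies |Δ_q^{(i)}(u)| ≤ C_i · (qΩ)^{−i−1}. -/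
open scoped BigOperators

/-- Near any point, `Delta ω q` is a finite sum when `ω` is supported in `(Ω, 2Ω)`. -/
theorem exists_Delta_eventuallyEq_sum {ω : ℝ → ℝ} {Ω : ℝ} (hΩ : 0 < Ω)
    (hsupp : tsupport ω ⊆ Set.Ioo Ω (2 * Ω)) {q : ℕ} (hq : 1 ≤ q) (u : ℝ) :
    ∃ N : ℕ, Delta ω q =ᶠ[nhds u] fun v => ∑ r ∈ Finset.range N,
      (1 / ((q : ℝ) * ((r : ℝ) + 1))) *
        (ω ((q : ℝ) * ((r : ℝ) + 1)) - ω (v / ((q : ℝ) * ((r : ℝ) + 1)))) := by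
  have hzero : ∀ x, ¬ (Ω < x ∧ x < 2 * Ω) → ω x = 0 := fun x hx =>
    image_eq_zero_of_notMem_tsupport fun h => hx (hsupp h)
  have hq' : (1 : ℝ) ≤ q := by exact_mod_cast hq
  obtain ⟨N, hN⟩ := exists_nat_ge (max (2 * Ω) ((u + 1) / Ω))
  refine ⟨N, ?_⟩
  filter_upwards [gt_mem_nhds (lt_add_one u)] with v hv
  refine tsum_eq_sum fun r hr => ?_
  have hr' : (N : ℝ) ≤ r := by exact_mod_cast not_lt.mp (by simpa using hr)
  have hx : (r : ℝ) + 1 ≤ q * (r + 1) := le_mul_of_one_le_left (by positivity) hq'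
  have hx0 : 0 < (q : ℝ) * (r + 1) := by positivity
  have h1 := (le_max_left _ _).trans hN
  have h2 := (div_le_iff₀ hΩ).mp ((le_max_right _ _).trans hN)
  rw [hzero (q * (r + 1)) fun h => by linarith [h.2],
    hzero (v / (q * (r + 1))) fun h => ?_, sub_zero, mul_zero]
  have h3 := (lt_div_iff₀ hx0).mp h.1
  nlinarith

/-- The `i`-th derivative of a single summand of `Delta`. -/
theorem iteratedDeriv_const_mul_sub_comp_div {i : ℕ} (hi : 1 ≤ i) {f : ℝ → ℝ}
    (hf : ContDiff ℝ i f) (a b x u : ℝ) :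
    iteratedDeriv i (fun v => a * (b - f (v / x))) u =
      -(a * ((x⁻¹) ^ i * iteratedDeriv i f (u / x))) := by
  have h := congrFun (iteratedDeriv_comp_const_mul hf x⁻¹) u
  simp only [div_eq_inv_mul] at h ⊢
  rw [iteratedDeriv_const_mul_field, iteratedDeriv_const_sub (by lia), iteratedDeriv_neg, h,
    mul_neg]

/-- For every `i ≥ 1` there is `C_i > 0`, depending only on `i` and the constants
`c 0, …, c i` bounding the derivatives of `ω` (and not on `q, u, Ω, U`), such that
`|Δ_q^{(i)}(u)| ≤ C_i (qΩ)^{-i-1}` for all `q ≥ 1` and `u ∈ ℝ`. -/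
theorem delta_q_derivative_bound :
    ∀ i : ℕ, 1 ≤ i → ∀ c : ℕ → ℝ,
      ∃ C : ℝ, 0 < C ∧
        ∀ (U Ω : ℝ), 0 < U → 0 < Ω →
          ∀ ω : ℝ → ℝ, ContDiff ℝ (⊤ : ℕ∞) ω → tsupport ω ⊆ Set.Ioo Ω (2 * Ω) →
            (∑' r : ℕ, ω ((r : ℝ) + 1)) = 1 →
            (∀ j : ℕ, j ≤ i → ∀ x : ℝ, |iteratedDeriv j ω x| ≤ c j * Ω ^ (-(j : ℝ) - 1)) →
            ∀ q : ℕ, 1 ≤ q → ∀ u : ℝ,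
              |iteratedDeriv i (fun v => Delta ω q v) u| ≤
                C * ((q : ℝ) * Ω) ^ (-(i : ℝ) - 1) := by
  intro i hi c
  have hsum : Summable fun r : ℕ => 1 / ((r : ℝ) + 1) ^ (i + 1) := by
    have h := (summable_nat_add_iff 1).mpr
      (Real.summable_one_div_nat_pow.mpr (by lia : 1 < i + 1))
    simpa using h
  set S := ∑' r : ℕ, 1 / ((r : ℝ) + 1) ^ (i + 1)
  have hS : 0 ≤ S := tsum_nonneg fun r => by positivity
  refine ⟨|c i| * S + 1, by positivity, ?_⟩
  intro U Ω _ hΩ ω hω hsupp _ hbound q hq u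
  have hq' : (0 : ℝ) < q := by exact_mod_cast hq
  have hpow : ∀ y : ℝ, 0 < y → y ^ (-(i : ℝ) - 1) = 1 / y ^ (i + 1) := fun y hy => by
    rw [show -(i : ℝ) - 1 = -((i + 1 : ℕ) : ℝ) by push_cast; ring, Real.rpow_neg hy.le,
      Real.rpow_natCast, one_div]
  have hωi : ContDiff ℝ i ω := hω.of_le (by exact_mod_cast le_top)
  obtain ⟨N, hN⟩ := exists_Delta_eventuallyEq_sum hΩ hsupp hq u
  have hterm : ∀ r : ℕ, ContDiff ℝ i fun v : ℝ => (1 / ((q : ℝ) * ((r : ℝ) + 1))) *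
      (ω ((q : ℝ) * ((r : ℝ) + 1)) - ω (v / ((q : ℝ) * ((r : ℝ) + 1)))) := fun r =>
    contDiff_const.mul (contDiff_const.sub (hωi.comp (contDiff_id.div_const _)))
  rw [hN.iteratedDeriv_eq, iteratedDeriv_fun_sum fun r _ => (hterm r).contDiffAt,
    hpow _ (by positivity)]
  calc |∑ r ∈ Finset.range N, iteratedDeriv i (fun v : ℝ => (1 / ((q : ℝ) * ((r : ℝ) + 1))) *
        (ω ((q : ℝ) * ((r : ℝ) + 1)) - ω (v / ((q : ℝ) * ((r : ℝ) + 1))))) u|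
      ≤ ∑ r ∈ Finset.range N,
          |c i| * (1 / ((q : ℝ) * Ω) ^ (i + 1)) * (1 / ((r : ℝ) + 1) ^ (i + 1)) := by
        refine (Finset.abs_sum_le_sum_abs _ _).trans (Finset.sum_le_sum fun r _ => ?_)
        have hx : (0 : ℝ) < q * (r + 1) := by positivity
        rw [iteratedDeriv_const_mul_sub_comp_div hi hωi, abs_neg, abs_mul, abs_mul,
          abs_of_pos (one_div_pos.mpr hx), abs_of_pos (pow_pos (inv_pos.mpr hx) i)]
        have hb : |iteratedDeriv i ω (u / (q * (r + 1)))| ≤ |c i| * (1 / Ω ^ (i + 1)) := by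
          refine (hbound i le_rfl _).trans ?_
          rw [hpow Ω hΩ]
          gcongr
          exact le_abs_self _
        calc _ ≤ 1 / ((q : ℝ) * (r + 1)) * (((q : ℝ) * (r + 1))⁻¹ ^ i *
              (|c i| * (1 / Ω ^ (i + 1)))) := by gcongr
          _ = _ := by
            simp only [mul_pow, inv_pow, pow_succ]
            field_simp
    _ = |c i| * (1 / ((q : ℝ) * Ω) ^ (i + 1)) *
          ∑ r ∈ Finset.range N, 1 / ((r : ℝ) + 1) ^ (i + 1) := by rw [Finset.mul_sum]
    _ ≤ |c i| * (1 / ((q : ℝ) * Ω) ^ (i + 1)) * S := by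
        gcongr
        exact hsum.sum_le_tsum _ fun r _ => by positivity
    _ ≤ (|c i| * S + 1) * (1 / ((q : ℝ) * Ω) ^ (i + 1)) := by
        have : 0 ≤ 1 / ((q : ℝ) * Ω) ^ (i + 1) := by positivity
        linarith
end

section
/- With the above data, regard Δ_t(u) := ∑_{r=1}^∞ (1/(tr)) [ω(tr) − ω(u/(tr))] as a function of a real variable t > 0. There is a constant C > 0, depending only on the constants c_0, c_1, c_2 bounding ω and its first two derivatives (and independent of t, u, Ω, U), such that for every real t ≥ 1 and every u ∈ ℝ the partial derivative in t satisfies |∂Δ_t(u)/∂t| ≤ C · (t^{−1}Ω^{−2} + t^{−2}Ω^{−1}). -/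
open scoped BigOperators

/-- `Δ_t(u) := ∑_{r=1}^∞ (1/(tr))·[ω(tr) − ω(u/(tr))]` for real `t > 0`. -/
noncomputable def DeltaR (ω : ℝ → ℝ) (t : ℝ) (u : ℝ) : ℝ :=
  ∑' r : ℕ, (1 / (t * ((r : ℝ) + 1))) *
    (ω (t * ((r : ℝ) + 1)) - ω (u / (t * ((r : ℝ) + 1))))

/-- The number of positive integers in a dyadic interval `(a, 2a)` is at most `a + 1`. -/
lemma card_filter_dyadic_le {a : ℝ} (ha : 0 ≤ a) (N : ℕ) :
    (((Finset.range N).filter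
      (fun r : ℕ => a < (r : ℝ) + 1 ∧ (r : ℝ) + 1 < 2 * a)).card : ℝ) ≤ a + 1 := by
  have h : ((Finset.range N).filter
      (fun r : ℕ => a < (r : ℝ) + 1 ∧ (r : ℝ) + 1 < 2 * a)).card
        ≤ (Finset.Ioc ⌊a⌋₊ ⌊2 * a⌋₊).card := by
    refine Finset.card_le_card_of_injOn (fun r => r + 1) ?_ ?_
    · intro r hr
      simp only [Finset.coe_filter, Finset.mem_range, Set.mem_ofPred_eq] at hr
      simp only [Finset.coe_Ioc, Set.mem_Ioc]
      refine ⟨(Nat.floor_lt ha).2 ?_, Nat.le_floor ?_⟩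
      · push_cast; exact hr.2.1
      · push_cast; exact hr.2.2.le
    · intro r _ s _ hrs
      simpa using hrs
  rw [Nat.card_Ioc] at h
  have hle : ⌊a⌋₊ ≤ ⌊2 * a⌋₊ := Nat.floor_mono (by linarith)
  have h1 : (((Finset.range N).filter
      (fun r : ℕ => a < (r : ℝ) + 1 ∧ (r : ℝ) + 1 < 2 * a)).card : ℝ)
        ≤ (⌊2 * a⌋₊ : ℝ) - ⌊a⌋₊ := by
    rw [← Nat.cast_sub hle]
    exact_mod_cast h
  have h2 := Nat.floor_le (show 0 ≤ 2 * a by linarith)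
  have h3 := Nat.lt_floor_add_one a
  linarith

/-- The sum of reciprocals of the positive integers in a dyadic interval is at most `2`. -/
lemma sum_inv_filter_dyadic_le (a : ℝ) (N : ℕ) :
    ∑ r ∈ (Finset.range N).filter
      (fun r : ℕ => a < (r : ℝ) + 1 ∧ (r : ℝ) + 1 < 2 * a), ((r : ℝ) + 1)⁻¹ ≤ 2 := by
  have bound : ∀ b : ℝ, 0 ≤ b →
      (∀ r : ℕ, a < (r : ℝ) + 1 → (r : ℝ) + 1 < 2 * a → ((r : ℝ) + 1)⁻¹ ≤ b) →
      (0 ≤ a → (a + 1) * b ≤ 2) →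
      ∑ r ∈ (Finset.range N).filter
        (fun r : ℕ => a < (r : ℝ) + 1 ∧ (r : ℝ) + 1 < 2 * a), ((r : ℝ) + 1)⁻¹ ≤ 2 := by
    intro b hb hterm hab
    have h := Finset.sum_le_card_nsmul ((Finset.range N).filter
      (fun r : ℕ => a < (r : ℝ) + 1 ∧ (r : ℝ) + 1 < 2 * a)) (fun r : ℕ => ((r : ℝ) + 1)⁻¹) b
      (fun r hr => hterm r (Finset.mem_filter.1 hr).2.1 (Finset.mem_filter.1 hr).2.2)
    rw [nsmul_eq_mul] at h
    rcases le_or_gt 0 a with ha | ha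
    · exact h.trans ((mul_le_mul_of_nonneg_right (card_filter_dyadic_le ha N) hb).trans (hab ha))
    · rw [Finset.filter_false_of_mem]
      · simp
      · rintro r _ ⟨_, h2⟩
        have : (0 : ℝ) ≤ r := r.cast_nonneg
        linarith
  rcases le_or_gt 1 a with ha | ha
  · refine bound a⁻¹ (by positivity) (fun r h1 _ => inv_anti₀ (by linarith) h1.le) (fun _ => ?_)
    rw [← div_eq_mul_inv, div_le_iff₀ (by linarith)]
    linarith
  · exact bound 1 zero_le_one
      (fun r _ _ => inv_le_one_of_one_le₀ (by have : (0 : ℝ) ≤ r := r.cast_nonneg; linarith))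
      (fun _ => by linarith)

/-- The `t`-derivative of a single summand of `DeltaR`. -/
lemma hasDerivAt_deltaR_term {ω : ℝ → ℝ} (hω : Differentiable ℝ ω) (u : ℝ) {t k : ℝ}
    (ht : 0 < t) (hk : 0 < k) :
    HasDerivAt (fun s : ℝ => (1 / (s * k)) * (ω (s * k) - ω (u / (s * k))))
      (t⁻¹ * ((deriv ω (t * k) - ω (t * k) / (t * k)) +
        (ω (u / (t * k)) + deriv ω (u / (t * k)) * (u / (t * k))) / (t * k))) t := by
  have hy : t * k ≠ 0 := by positivity
  have h1 : HasDerivAt (fun s : ℝ => s * k) k t := by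
    simpa using (hasDerivAt_id t).mul_const k
  have h2 : HasDerivAt (fun s : ℝ => 1 / (s * k)) _ t :=
    (hasDerivAt_const t (1 : ℝ)).div h1 hy
  have h3 : HasDerivAt (fun s : ℝ => u / (s * k)) _ t :=
    (hasDerivAt_const t u).div h1 hy
  have h4 : HasDerivAt (fun s : ℝ => ω (s * k)) _ t :=
    HasDerivAt.comp t (hω (t * k)).hasDerivAt h1
  have h5 : HasDerivAt (fun s : ℝ => ω (u / (s * k))) _ t :=
    HasDerivAt.comp t (hω (u / (t * k))).hasDerivAt h3
  refine (h2.mul (h4.sub h5)).congr_deriv ?_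
  simp only [Pi.sub_apply]
  field_simp
  ring

/-- Near `t > 0` only finitely many summands of `DeltaR ω · u` are nonzero. -/
lemma exists_deltaR_eventuallyEq_sum {ω : ℝ → ℝ} {Ω : ℝ} (hΩ : 0 < Ω)
    (hzero : ∀ x, ¬ (Ω < x ∧ x < 2 * Ω) → ω x = 0) (u : ℝ) {t : ℝ} (ht : 0 < t) :
    ∃ N : ℕ, (fun s : ℝ => DeltaR ω s u) =ᶠ[nhds t]
      fun s => ∑ r ∈ Finset.range N, (1 / (s * ((r : ℝ) + 1))) *
        (ω (s * ((r : ℝ) + 1)) - ω (u / (s * ((r : ℝ) + 1)))) := by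
  obtain ⟨N, hN⟩ := exists_nat_ge (max (2 * Ω) (|u| / Ω) / (t / 2))
  refine ⟨N, ?_⟩
  filter_upwards [lt_mem_nhds (half_lt_self ht)] with s hs
  refine tsum_eq_sum fun r hr => ?_
  have hr' : (N : ℝ) ≤ r := by simpa using hr
  have hs0 : 0 < s := by linarith
  have hy : max (2 * Ω) (|u| / Ω) ≤ s * ((r : ℝ) + 1) := by
    rw [div_le_iff₀ (by linarith)] at hN
    have h0 : (0 : ℝ) ≤ N := N.cast_nonneg
    nlinarith
  have hy0 : 0 < s * ((r : ℝ) + 1) := by positivity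
  have hy1 := (le_max_left _ _).trans hy
  have hy2 := (le_max_right _ _).trans hy
  rw [hzero (s * ((r : ℝ) + 1)) (fun h => by linarith [h.2]),
    hzero (u / (s * ((r : ℝ) + 1))) (fun h => ?_)]
  · simp
  · have h1 := h.1
    rw [lt_div_iff₀ hy0] at h1
    rw [div_le_iff₀ hΩ] at hy2
    linarith [le_abs_self u]

/-- Pointwise bound for the derivative of a summand of `DeltaR`, with the supports recorded by
indicators of dyadic intervals. -/
lemma abs_deltaR_term_deriv_le {ω : ℝ → ℝ} {Ω c₀ c₁ : ℝ} (hΩ : 0 < Ω)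
    (hzero : ∀ x, ¬ (Ω < x ∧ x < 2 * Ω) → ω x = 0 ∧ deriv ω x = 0)
    (h₀ : ∀ x, |ω x| ≤ c₀ / Ω) (h₁ : ∀ x, |deriv ω x| ≤ c₁ / Ω ^ 2)
    (u : ℝ) {t k : ℝ} (ht : 0 < t) (hk : 0 < k) :
    |t⁻¹ * ((deriv ω (t * k) - ω (t * k) / (t * k)) +
        (ω (u / (t * k)) + deriv ω (u / (t * k)) * (u / (t * k))) / (t * k))| ≤
      (c₀ + 2 * c₁) * (t * Ω ^ 2)⁻¹ * (if Ω / t < k ∧ k < 2 * (Ω / t) then 1 else 0) +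
      (c₀ + 2 * c₁) * (t ^ 2 * Ω)⁻¹ *
        (if u / (2 * Ω * t) < k ∧ k < 2 * (u / (2 * Ω * t)) then k⁻¹ else 0) := by
  have hy : 0 < t * k := by positivity
  have hc₁ : 0 ≤ c₁ := by
    have := (abs_nonneg _).trans (h₁ 0)
    rwa [le_div_iff₀ (by positivity), zero_mul] at this
  have hA : |deriv ω (t * k) - ω (t * k) / (t * k)| ≤
      (c₀ + 2 * c₁) * (Ω ^ 2)⁻¹ * (if Ω / t < k ∧ k < 2 * (Ω / t) then 1 else 0) := by
    split_ifs with h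
    · have hy1 : Ω ≤ t * k := by
        have := h.1
        rw [div_lt_iff₀ ht] at this
        linarith
      calc |deriv ω (t * k) - ω (t * k) / (t * k)|
          ≤ |deriv ω (t * k)| + |ω (t * k)| / (t * k) := by
            refine (abs_sub _ _).trans_eq ?_
            rw [abs_div, abs_of_pos hy]
        _ ≤ c₁ / Ω ^ 2 + (c₀ / Ω) / Ω := by
            refine add_le_add (h₁ _) ?_
            exact div_le_div₀ ((abs_nonneg _).trans (h₀ 0)) (h₀ _) hΩ hy1
        _ ≤ c₁ / Ω ^ 2 + (c₀ / Ω) / Ω + c₁ / Ω ^ 2 := le_add_of_nonneg_right (by positivity)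
        _ = (c₀ + 2 * c₁) * (Ω ^ 2)⁻¹ * 1 := by field_simp; ring
    · have := hzero (t * k) (fun h' => h ⟨by rw [div_lt_iff₀ ht]; linarith [h'.1], by
        rw [← mul_div_assoc, lt_div_iff₀ ht]; linarith [h'.2]⟩)
      simp [this.1, this.2]
  have hB : |(ω (u / (t * k)) + deriv ω (u / (t * k)) * (u / (t * k))) / (t * k)| ≤
      (c₀ + 2 * c₁) * (t * Ω)⁻¹ *
        (if u / (2 * Ω * t) < k ∧ k < 2 * (u / (2 * Ω * t)) then k⁻¹ else 0) := by
    have hiff : (Ω < u / (t * k) ∧ u / (t * k) < 2 * Ω) ↔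
        (u / (2 * Ω * t) < k ∧ k < 2 * (u / (2 * Ω * t))) := by
      rw [lt_div_iff₀ hy, div_lt_iff₀ hy, div_lt_iff₀ (by positivity), ← mul_div_assoc,
        lt_div_iff₀ (by positivity)]
      constructor <;> rintro ⟨h, h'⟩ <;> constructor <;> linarith
    split_ifs with h
    · obtain ⟨hz1, hz2⟩ := hiff.2 h
      have hz0 : 0 < u / (t * k) := hΩ.trans hz1
      rw [abs_div, abs_of_pos hy, div_le_iff₀ hy]
      calc |ω (u / (t * k)) + deriv ω (u / (t * k)) * (u / (t * k))|
          ≤ |ω (u / (t * k))| + |deriv ω (u / (t * k))| * (u / (t * k)) := by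
            refine (abs_add_le _ _).trans_eq ?_
            rw [abs_mul, abs_of_pos hz0]
        _ ≤ c₀ / Ω + c₁ / Ω ^ 2 * (2 * Ω) :=
            add_le_add (h₀ _) (mul_le_mul (h₁ _) hz2.le hz0.le (by positivity))
        _ = (c₀ + 2 * c₁) * (t * Ω)⁻¹ * k⁻¹ * (t * k) := by field_simp
    · have := hzero (u / (t * k)) (fun h' => h (hiff.1 h'))
      simp [this.1, this.2]
  rw [abs_mul, abs_of_pos (inv_pos.2 ht)]
  refine (mul_le_mul_of_nonneg_left ((abs_add_le _ _).trans (add_le_add hA hB))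
    (inv_pos.2 ht).le).trans_eq ?_
  rw [mul_inv, mul_inv, mul_inv, sq t, mul_inv]
  ring

/-- There is `C > 0`, depending only on the constants `c₀, c₁, c₂` bounding `ω` and
its first two derivatives (and not on `t, u, Ω, U`), such that
`|∂Δ_t(u)/∂t| ≤ C (t^{-1}Ω^{-2} + t^{-2}Ω^{-1})` for all real `t ≥ 1` and `u ∈ ℝ`. -/
theorem delta_t_partial_derivative_bound :
    ∀ c₀ c₁ c₂ : ℝ,
      ∃ C : ℝ, 0 < C ∧
        ∀ (U Ω : ℝ), 0 < U → 0 < Ω →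
          ∀ ω : ℝ → ℝ, ContDiff ℝ (⊤ : ℕ∞) ω → tsupport ω ⊆ Set.Ioo Ω (2 * Ω) →
            (∑' r : ℕ, ω ((r : ℝ) + 1)) = 1 →
            (∀ x : ℝ, |ω x| ≤ c₀ * Ω ^ (-(1 : ℝ))) →
            (∀ x : ℝ, |deriv ω x| ≤ c₁ * Ω ^ (-(2 : ℝ))) →
            (∀ x : ℝ, |iteratedDeriv 2 ω x| ≤ c₂ * Ω ^ (-(3 : ℝ))) →
            ∀ t : ℝ, 1 ≤ t → ∀ u : ℝ,
              |deriv (fun s : ℝ => DeltaR ω s u) t| ≤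
                C * (t⁻¹ * Ω ^ (-(2 : ℝ)) + t ^ (-(2 : ℝ)) * Ω⁻¹) := by
  intro c₀ c₁ c₂
  refine ⟨3 * (|c₀| + 2 * |c₁|) + 1, by positivity, ?_⟩
  intro U Ω _ hΩ ω hω hsupp _ h₀ h₁ _ t ht u
  have ht0 : 0 < t := by linarith
  have e1 : Ω ^ (-(1 : ℝ)) = Ω⁻¹ := Real.rpow_neg_one Ω
  have e2 : ∀ x : ℝ, 0 < x → x ^ (-(2 : ℝ)) = (x ^ 2)⁻¹ := fun x hx => by
    rw [Real.rpow_neg hx.le, Real.rpow_two]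
  rw [e2 t ht0, e2 Ω hΩ]
  simp only [e1, e2 Ω hΩ, ← div_eq_mul_inv] at h₀ h₁
  have hzero : ∀ x, ¬ (Ω < x ∧ x < 2 * Ω) → ω x = 0 ∧ deriv ω x = 0 := fun x hx => by
    have hx' : x ∉ tsupport ω := fun h => hx (hsupp h)
    exact ⟨image_eq_zero_of_notMem_tsupport hx',
      Function.notMem_support.1 fun h => hx' (support_deriv_subset h)⟩
  have h₀' : ∀ x, |ω x| ≤ |c₀| / Ω := fun x =>
    (h₀ x).trans (div_le_div_of_nonneg_right (le_abs_self _) hΩ.le)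
  have h₁' : ∀ x, |deriv ω x| ≤ |c₁| / Ω ^ 2 := fun x =>
    (h₁ x).trans (div_le_div_of_nonneg_right (le_abs_self _) (by positivity))
  obtain ⟨N, hN⟩ := exists_deltaR_eventuallyEq_sum hΩ (fun x hx => (hzero x hx).1) u ht0
  have hdiff : Differentiable ℝ ω := hω.differentiable (by simp)
  have hder := HasDerivAt.fun_sum (u := Finset.range N) fun r _ =>
    hasDerivAt_deltaR_term hdiff u ht0 (Nat.cast_add_one_pos r)
  rw [hN.deriv_eq, hder.deriv]
  set K := |c₀| + 2 * |c₁| with hK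
  have hK0 : 0 ≤ K := by positivity
  refine (Finset.abs_sum_le_sum_abs _ _).trans ((Finset.sum_le_sum fun r _ =>
    abs_deltaR_term_deriv_le hΩ hzero h₀' h₁' u ht0
      (Nat.cast_add_one_pos r)).trans ?_)
  rw [Finset.sum_add_distrib, ← Finset.mul_sum, ← Finset.mul_sum, ← Finset.sum_filter,
    ← Finset.sum_filter, Finset.sum_const, nsmul_one, ← hK]
  have hA := card_filter_dyadic_le (a := Ω / t) (by positivity) N
  have hB := sum_inv_filter_dyadic_le (u / (2 * Ω * t)) N
  refine (add_le_add (mul_le_mul_of_nonneg_left hA (by positivity))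
    (mul_le_mul_of_nonneg_left hB (by positivity))).trans ?_
  have hp : 0 < t⁻¹ * (Ω ^ 2)⁻¹ := by positivity
  have hq : 0 < (t ^ 2)⁻¹ * Ω⁻¹ := by positivity
  have e3 : K * (t * Ω ^ 2)⁻¹ * (Ω / t + 1) + K * (t ^ 2 * Ω)⁻¹ * 2 =
      K * (t⁻¹ * (Ω ^ 2)⁻¹) + 3 * K * ((t ^ 2)⁻¹ * Ω⁻¹) := by
    field_simp
    ring
  rw [e3]
  nlinarith [mul_nonneg hK0 hp.le, mul_nonneg hK0 hq.le]
end
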